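/- arXiv:2003.00999 — 6 statements merged into one kernel-verified Lean document; each statement's English description precedes it below -/
import Mathlib

section
/- Let M be a distributive meet-semilattice with top element. For every subset F ⊆ M, F is an irreducible filter of M if and only if the complement M \ F is a ∧-prime order ideal of M. -/
/-- A meet-semilattice with top is distributive when for all `a, b₁, b₂` with
`b₁ ⊓ b₂ ≤ a` there are `c₁, c₂` with `b₁ ≤ c₁`, `b₂ ≤ c₂` and `a = c₁ ⊓ c₂`. -/
def IsDistribMSL (M : Type*) [SemilatticeInf M] [OrderTop M] : Prop :=
  ∀ a b₁ b₂ : M, b₁ ⊓ b₂ ≤ a → ∃ c₁ c₂ : M, b₁ ≤ c₁ ∧ b₂ ≤ c₂ ∧ a = c₁ ⊓ c₂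

/-- A (meet) filter of a meet-semilattice: a nonempty up-set closed under meet. -/
def IsMSLFilter {M : Type*} [SemilatticeInf M] (F : Set M) : Prop :=
  F.Nonempty ∧ (∀ a ∈ F, ∀ b : M, a ≤ b → b ∈ F) ∧ ∀ a ∈ F, ∀ b ∈ F, a ⊓ b ∈ F

/-- An irreducible filter: a meet-irreducible element of the lattice of filters
(where the meet of two filters is their intersection). -/
def IsIrrMSLFilter {M : Type*} [SemilatticeInf M] (F : Set M) : Prop :=
  IsMSLFilter F ∧ F ≠ Set.univ ∧
    ∀ G H : Set M, IsMSLFilter G → IsMSLFilter H → F = G ∩ H → F = G ∨ F = H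

/-- `∧`-prime subsets: proper subsets `X` such that whenever the meet of a
nonempty finite set belongs to `X`, some element of the set belongs to `X`. -/
def IsMeetPrime {M : Type*} [SemilatticeInf M] (X : Set M) : Prop :=
  X ≠ Set.univ ∧ ∀ (U : Finset M) (hU : U.Nonempty), U.inf' hU id ∈ X → ∃ u ∈ U, u ∈ X

/-- Order ideals: nonempty up-directed down-sets. -/
def IsOrderIdeal {M : Type*} [Preorder M] (I : Set M) : Prop :=
  I.Nonempty ∧ (∀ a ∈ I, ∀ b : M, b ≤ a → b ∈ I) ∧ DirectedOn (· ≤ ·) I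

/-- The filter generated by a filter `F` and an element `a`. -/
def IsMSLFilter.adjoin {M : Type*} [SemilatticeInf M] (F : Set M) (a : M) : Set M :=
  {x | ∃ f ∈ F, f ⊓ a ≤ x}

namespace IsMSLFilter

variable {M : Type*} [SemilatticeInf M] {F : Set M}

theorem subset_adjoin (a : M) : F ⊆ adjoin F a :=
  fun x hx => ⟨x, hx, inf_le_left⟩

theorem mem_adjoin_self (hF : IsMSLFilter F) (a : M) : a ∈ adjoin F a :=
  let ⟨f, hf⟩ := hF.1
  ⟨f, hf, inf_le_right⟩

theorem isMSLFilter_adjoin (hF : IsMSLFilter F) (a : M) : IsMSLFilter (adjoin F a) := by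
  refine ⟨⟨a, hF.mem_adjoin_self a⟩, ?_, ?_⟩
  · rintro x ⟨f, hf, hfx⟩ y hxy
    exact ⟨f, hf, hfx.trans hxy⟩
  · rintro x ⟨f, hf, hfx⟩ y ⟨g, hg, hgy⟩
    exact ⟨f ⊓ g, hF.2.2 f hf g hg, le_inf ((inf_le_inf_right a inf_le_left).trans hfx)
      ((inf_le_inf_right a inf_le_right).trans hgy)⟩

/-- In a distributive meet-semilattice, an element of the filter generated by `F` and `a` that
lies outside `F` has an upper bound in common with `a` outside `F`. -/
theorem exists_le_notMem_of_mem_adjoin [OrderTop M] (hM : IsDistribMSL M) (hF : IsMSLFilter F)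
    {a x : M} (hx : x ∈ adjoin F a) (hxF : x ∉ F) : ∃ c ∉ F, a ≤ c ∧ x ≤ c := by
  obtain ⟨f, hf, hfx⟩ := hx
  obtain ⟨c₁, c₂, h₁, h₂, rfl⟩ := hM x f a hfx
  exact ⟨c₂, fun hc => hxF (hF.2.2 c₁ (hF.2.1 f hf c₁ h₁) c₂ hc), h₂, inf_le_right⟩

end IsMSLFilter

theorem IsIrrMSLFilter.directedOn_compl {M : Type*} [SemilatticeInf M] [OrderTop M]
    (hM : IsDistribMSL M) {F : Set M} (h : IsIrrMSLFilter F) : DirectedOn (· ≤ ·) Fᶜ := by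
  obtain ⟨hF, -, hirr⟩ := h
  intro a ha b hb
  have hex : ∃ x ∉ F, x ∈ IsMSLFilter.adjoin F a ∧ x ∈ IsMSLFilter.adjoin F b := by
    by_contra! hcon
    have heq : F = IsMSLFilter.adjoin F a ∩ IsMSLFilter.adjoin F b :=
      Set.Subset.antisymm
        (Set.subset_inter (IsMSLFilter.subset_adjoin a) (IsMSLFilter.subset_adjoin b))
        fun x hx => by_contra fun hxF => hcon x hxF hx.1 hx.2
    rcases hirr _ _ (hF.isMSLFilter_adjoin a) (hF.isMSLFilter_adjoin b) heq with h | h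
    · exact ha (h.superset (hF.mem_adjoin_self a))
    · exact hb (h.superset (hF.mem_adjoin_self b))
  obtain ⟨x, hxF, hxa, hxb⟩ := hex
  obtain ⟨c, hcF, hac, hxc⟩ := hF.exists_le_notMem_of_mem_adjoin hM hxa hxF
  obtain ⟨d, hdF, hbd, hcd⟩ := hF.exists_le_notMem_of_mem_adjoin hM
    ((hF.isMSLFilter_adjoin b).2.1 x hxb c hxc) hcF
  exact ⟨d, hdF, hac.trans hcd, hbd⟩

/-- A set whose complement is a `∧`-prime order ideal is a filter. -/
theorem IsMeetPrime.isMSLFilter {M : Type*} [SemilatticeInf M] {F : Set M}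
    (hI : IsOrderIdeal Fᶜ) (hP : IsMeetPrime Fᶜ) : IsMSLFilter F := by
  classical
  refine ⟨Set.nonempty_iff_ne_empty.2 fun h => hP.1 (by simp [h]), ?_, ?_⟩
  · intro a ha b hab
    by_contra hb
    exact hI.2.1 b hb a hab ha
  · intro a ha b hb
    by_contra hab
    obtain ⟨u, hu, huF⟩ := hP.2 {a, b} (Finset.insert_nonempty a {b}) (by simpa using hab)
    rcases Finset.mem_insert.1 hu with rfl | hu
    · exact huF ha
    · exact huF (Finset.mem_singleton.1 hu ▸ hb)

/-- For a distributive meet-semilattice with top, `F` is an irreducible filter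
iff its complement is a `∧`-prime order ideal. -/
theorem irreducible_filter_iff_compl_prime_order_ideal
    {M : Type*} [SemilatticeInf M] [OrderTop M] (hM : IsDistribMSL M) (F : Set M) :
    IsIrrMSLFilter F ↔ (IsOrderIdeal Fᶜ ∧ IsMeetPrime Fᶜ) := by
  constructor
  · intro h
    obtain ⟨hF, hne, -⟩ := id h
    refine ⟨⟨Set.nonempty_compl.2 hne, fun a ha b hba hb => ha (hF.2.1 b hb a hba),
      h.directedOn_compl hM⟩, ?_, ?_⟩
    · obtain ⟨f, hf⟩ := hF.1
      exact fun hu => hu.superset (Set.mem_univ f) hf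
    · intro U hU hinf
      by_contra! hcon
      exact hinf (Finset.inf'_mem F hF.2.2 U hU id fun u hu => not_not.1 (hcon u hu))
  · rintro ⟨hI, hP⟩
    refine ⟨hP.isMSLFilter hI, Set.nonempty_compl.1 hI.1, ?_⟩
    intro G H hG hH heq
    by_contra! hcon
    obtain ⟨a, haG, haF⟩ := Set.not_subset.1 fun hs =>
      hcon.1 (Set.Subset.antisymm (heq.subset.trans Set.inter_subset_left) hs)
    obtain ⟨b, hbH, hbF⟩ := Set.not_subset.1 fun hs =>
      hcon.2 (Set.Subset.antisymm (heq.subset.trans Set.inter_subset_right) hs)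
    obtain ⟨c, hcF, hac, hbc⟩ := hI.2.2 a haF b hbF
    exact hcF (heq.superset ⟨hG.2.1 a haG c hac, hH.2.1 b hbH c hbc⟩)
end

section
/- Let M be a distributive meet-semilattice with top element. For every subset F ⊆ M, F is an optimal filter of M if and only if the complement M \ F is a ∧-prime Frink ideal of M. -/
/-- Frink ideals of a poset: `I` such that whenever every common upper bound of
a finite subset of `I` is above `b`, then `b ∈ I`. -/
def IsFrinkIdeal {M : Type*} [Preorder M] (I : Set M) : Prop :=
  ∀ I' : Finset M, ↑I' ⊆ I → ∀ b : M, (∀ c : M, (∀ a ∈ I', a ≤ c) → b ≤ c) → b ∈ I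

/-- Optimal filters: filters `F` for which there is a Frink ideal `I` such that
`F` is maximal among filters disjoint from `I` and `I` is maximal among Frink
ideals disjoint from `F`. -/
def IsOptMSLFilter {M : Type*} [SemilatticeInf M] (F : Set M) : Prop :=
  IsMSLFilter F ∧ ∃ I : Set M, IsFrinkIdeal I ∧ F ∩ I = ∅ ∧
    (∀ G : Set M, IsMSLFilter G → G ∩ I = ∅ → F ⊆ G → G = F) ∧
    (∀ J : Set M, IsFrinkIdeal J → F ∩ J = ∅ → I ⊆ J → J = I)

/-- Frink ideals are down-sets. -/
theorem IsFrinkIdeal.isLowerSet {M : Type*} [Preorder M] {I : Set M} (hI : IsFrinkIdeal I) :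
    IsLowerSet I := by
  intro a b hba ha
  refine hI {a} (by simpa using ha) b fun c hc => ?_
  exact hba.trans (hc a (Finset.mem_singleton_self a))

/-- The explicit description of the Frink ideal generated by `I ∪ {a}`. -/
def frinkAdjoin {M : Type*} [Preorder M] (I : Set M) (a : M) : Set M :=
  {b | ∃ I' : Finset M, ↑I' ⊆ I ∧ ∀ c : M, (∀ x ∈ I', x ≤ c) → a ≤ c → b ≤ c}

theorem isFrinkIdeal_frinkAdjoin {M : Type*} [Preorder M] (I : Set M) (a : M) :
    IsFrinkIdeal (frinkAdjoin I a) := by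
  classical
  intro K hK b hb
  choose! s hsI hs using fun k (hk : k ∈ K) => hK (Finset.mem_coe.2 hk)
  refine ⟨K.biUnion s, ?_, fun c hc hac => hb c fun k hk => hs k hk c (fun x hx => ?_) hac⟩
  · simpa using hsI
  · exact hc x (Finset.mem_biUnion.2 ⟨k, hk, hx⟩)

theorem subset_frinkAdjoin {M : Type*} [Preorder M] (I : Set M) (a : M) :
    I ⊆ frinkAdjoin I a := fun b hb =>
  ⟨{b}, by simpa using hb, fun _ hc _ => hc b (Finset.mem_singleton_self b)⟩

theorem mem_frinkAdjoin_self {M : Type*} [Preorder M] (I : Set M) (a : M) :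
    a ∈ frinkAdjoin I a :=
  ⟨∅, by simp, fun _ _ h => h⟩

/-- The up-set of the meets `f ⊓ a` with `f` in a filter `F` is a filter. -/
theorem IsMSLFilter.adjoin_s1 {M : Type*} [SemilatticeInf M] {F : Set M} (hF : IsMSLFilter F)
    (a : M) : IsMSLFilter {b | ∃ f ∈ F, f ⊓ a ≤ b} := by
  obtain ⟨⟨f₀, hf₀⟩, -, hinf⟩ := hF
  refine ⟨⟨f₀ ⊓ a, f₀, hf₀, le_rfl⟩, ?_, ?_⟩
  · rintro b ⟨f, hf, hfb⟩ c hbc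
    exact ⟨f, hf, hfb.trans hbc⟩
  · rintro b ⟨f, hf, hfb⟩ c ⟨g, hg, hgc⟩
    refine ⟨f ⊓ g, hinf f hf g hg, le_inf ?_ ?_⟩
    · exact (inf_le_inf_right a inf_le_left).trans hfb
    · exact (inf_le_inf_right a inf_le_right).trans hgc

/-- In a distributive meet-semilattice, an element `f` lies in a Frink ideal `I` as soon as
`f ⊓ a` lies in `I` and `f` lies in the Frink ideal generated by `I ∪ {a}`. -/
theorem IsFrinkIdeal.mem_of_inf_mem_of_mem_frinkAdjoin {M : Type*} [SemilatticeInf M] [OrderTop M]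
    (hM : IsDistribMSL M) {I : Set M} (hI : IsFrinkIdeal I) {a f : M} (hfa : f ⊓ a ∈ I)
    (hf : f ∈ frinkAdjoin I a) : f ∈ I := by
  classical
  obtain ⟨s, hsI, hs⟩ := hf
  refine hI (insert (f ⊓ a) s) (by simpa [Set.insert_subset_iff] using ⟨hfa, hsI⟩) f
    fun c hc => ?_
  obtain ⟨c₁, c₂, hfc₁, hac₂, rfl⟩ := hM c f a (hc _ (Finset.mem_insert_self _ _))
  exact le_inf hfc₁
    (hs c₂ (fun x hx => (hc x (Finset.mem_insert_of_mem hx)).trans inf_le_right) hac₂)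

/-- In a distributive meet-semilattice, a filter and a Frink ideal that are maximal with respect
to being disjoint from each other are complementary. -/
theorem compl_eq_of_maximal_disjoint {M : Type*} [SemilatticeInf M] [OrderTop M]
    (hM : IsDistribMSL M) {F I : Set M} (hF : IsMSLFilter F) (hI : IsFrinkIdeal I)
    (hFI : F ∩ I = ∅)
    (hFmax : ∀ G : Set M, IsMSLFilter G → G ∩ I = ∅ → F ⊆ G → G = F)
    (hImax : ∀ J : Set M, IsFrinkIdeal J → F ∩ J = ∅ → I ⊆ J → J = I) : Fᶜ = I := by
  have hdisj : ∀ x ∈ F, x ∉ I := fun x hxF hxI => Set.eq_empty_iff_forall_notMem.1 hFI x ⟨hxF, hxI⟩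
  refine Set.Subset.antisymm (fun a haF => ?_) fun x hxI hxF => hdisj x hxF hxI
  by_contra haI
  obtain ⟨⟨f₀, hf₀⟩, -, hinf⟩ := id hF
  obtain ⟨f, hf, hfa⟩ : ∃ f ∈ F, f ⊓ a ∈ I := by
    by_contra! h
    refine haF ((hFmax _ (hF.adjoin_s1 a) ?_ fun f hf => ⟨f, hf, inf_le_left⟩) ▸
      ⟨f₀, hf₀, inf_le_right⟩)
    refine Set.eq_empty_iff_forall_notMem.2 ?_
    rintro b ⟨⟨f, hf, hfb⟩, hbI⟩
    exact h f hf (hI.isLowerSet hfb hbI)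
  obtain ⟨g, hg, hgJ⟩ : (F ∩ frinkAdjoin I a).Nonempty := by
    by_contra h
    exact haI (hImax _ (isFrinkIdeal_frinkAdjoin I a) (Set.not_nonempty_iff_eq_empty.1 h)
      (subset_frinkAdjoin I a) ▸ mem_frinkAdjoin_self I a)
  refine hdisj (f ⊓ g) (hinf f hf g hg) (hI.mem_of_inf_mem_of_mem_frinkAdjoin hM (a := a) ?_ ?_)
  · exact hI.isLowerSet (inf_le_inf_right a inf_le_left) hfa
  · exact (isFrinkIdeal_frinkAdjoin I a).isLowerSet inf_le_right hgJ

theorem IsMSLFilter.isMeetPrime_compl {M : Type*} [SemilatticeInf M] {F : Set M}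
    (hF : IsMSLFilter F) : IsMeetPrime Fᶜ := by
  obtain ⟨hne, -, hinf⟩ := hF
  refine ⟨fun h => hne.ne_empty (Set.compl_univ_iff.1 h), fun U hU hUF => ?_⟩
  by_contra! h
  exact hUF (Finset.inf'_mem F hinf U hU id fun u hu => not_not.1 (h u hu))

theorem IsMeetPrime.isMSLFilter_of_compl {M : Type*} [SemilatticeInf M] {F : Set M}
    (hF : IsMeetPrime Fᶜ) (hlow : IsLowerSet Fᶜ) : IsMSLFilter F := by
  classical
  refine ⟨Set.nonempty_iff_ne_empty.2 fun h => hF.1 (by simp [h]),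
    fun a ha b hab => not_not.1 fun hb => hlow hab hb ha, fun a ha b hb => ?_⟩
  by_contra hab
  obtain ⟨u, hu, huF⟩ := hF.2 {a, b} (by simp) (by simpa [Finset.inf'_insert] using hab)
  rcases Finset.mem_insert.1 hu with rfl | hu
  · exact huF ha
  · exact huF (Finset.mem_singleton.1 hu ▸ hb)

/-- For a distributive meet-semilattice with top, `F` is an optimal filter iff
its complement is a `∧`-prime Frink ideal. -/
theorem optimal_filter_iff_compl_prime_frink_ideal
    {M : Type*} [SemilatticeInf M] [OrderTop M] (hM : IsDistribMSL M) (F : Set M) :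
    IsOptMSLFilter F ↔ (IsFrinkIdeal Fᶜ ∧ IsMeetPrime Fᶜ) := by
  constructor
  · rintro ⟨hF, I, hI, hFI, hFmax, hImax⟩
    rw [and_iff_left hF.isMeetPrime_compl,
      compl_eq_of_maximal_disjoint hM hF hI hFI hFmax hImax]
    exact hI
  · rintro ⟨hI, hprime⟩
    refine ⟨hprime.isMSLFilter_of_compl hI.isLowerSet, Fᶜ, hI, Set.inter_compl_self F, ?_, ?_⟩
    · intro G _ hG hFG
      exact (Set.sdiff_eq_empty.1 hG).antisymm hFG
    · intro J _ hJ hIJ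
      exact (Set.disjoint_iff_inter_eq_empty.2 hJ).subset_compl_left.antisymm hIJ
end

section
/- Let S be a congruential logic and A an S-algebra. A set I ⊆ A is a strong S-ideal of A if and only if I is a down-set with respect to the specialization order ≤ and I satisfies the strong-ideal condition. -/
/-- An algebraic language: a type of function symbols with finite arities. -/
structure Lang where
  F : Type
  ar : F → ℕ

/-- An algebra for the language `L` on the carrier `A`. -/
structure AlgStr (L : Lang) (A : Type) where
  op : ∀ f : L.F, (Fin (L.ar f) → A) → A

/-- Formulas (terms) of `L` over countably many variables. -/
inductive Fm (L : Lang) : Type where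
  | var : ℕ → Fm L
  | node : (f : L.F) → (Fin (L.ar f) → Fm L) → Fm L

/-- The absolutely free algebra of formulas (the term algebra). -/
def FmAlg (L : Lang) : AlgStr L (Fm L) := ⟨Fm.node⟩

/-- Homomorphisms of algebras. -/
def IsHom {L : Lang} {A B : Type} (SA : AlgStr L A) (SB : AlgStr L B) (h : A → B) : Prop :=
  ∀ (f : L.F) (args : Fin (L.ar f) → A), h (SA.op f args) = SB.op f fun i => h (args i)

/-- A logic (deductive system) in the language `L`: a substitution-invariant
consequence relation on formulas. -/
structure Logic (L : Lang) where
  Thm : Set (Fm L) → Fm L → Prop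
  refl : ∀ Γ γ, γ ∈ Γ → Thm Γ γ
  cut : ∀ Γ Δ δ, (∀ γ ∈ Γ, Thm Δ γ) → Thm Γ δ → Thm Δ δ
  subst_inv : ∀ Γ δ (σ : Fm L → Fm L), IsHom (FmAlg L) (FmAlg L) σ →
    Thm Γ δ → Thm (σ '' Γ) (σ δ)

variable {L : Lang} {A : Type}

/-- A logic has theorems when some formula follows from the empty set. -/
def HasTheorems (S : Logic L) : Prop := ∃ δ : Fm L, S.Thm ∅ δ

/-- `S`-filters of an algebra. -/
def IsSFilter (S : Logic L) (SA : AlgStr L A) (F : Set A) : Prop :=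
  ∀ h : Fm L → A, IsHom (FmAlg L) SA h →
    ∀ (Γ : Set (Fm L)) (δ : Fm L), S.Thm Γ δ → (∀ γ ∈ Γ, h γ ∈ F) → h δ ∈ F

/-- The `S`-filter generated by a subset. -/
def Fg (S : Logic L) (SA : AlgStr L A) (B : Set A) : Set A :=
  ⋂₀ {F | IsSFilter S SA F ∧ B ⊆ F}

/-- The specialization quasiorder of an algebra. -/
def SpecLe (S : Logic L) (SA : AlgStr L A) (a b : A) : Prop :=
  Fg S SA {b} ⊆ Fg S SA {a}

/-- Congruences of an algebra. -/
def IsCongr (SA : AlgStr L A) (r : A → A → Prop) : Prop :=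
  Equivalence r ∧ ∀ (f : L.F) (x y : Fin (L.ar f) → A),
    (∀ i, r (x i) (y i)) → r (SA.op f x) (SA.op f y)

/-- A logic is congruential when the specialization equivalence is a congruence
of every algebra. -/
def Congruential (S : Logic L) : Prop :=
  ∀ (A : Type) (SA : AlgStr L A),
    IsCongr SA fun a b => SpecLe S SA a b ∧ SpecLe S SA b a

/-- `S`-algebras: the identity is the only congruence below the specialization
equivalence. -/
def IsSAlgebra (S : Logic L) (SA : AlgStr L A) : Prop :=
  ∀ r : A → A → Prop, IsCongr SA r →
    (∀ a b, r a b → SpecLe S SA a b ∧ SpecLe S SA b a) → ∀ a b, r a b → a = b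

/-- Finitary logics. -/
def Finitary (S : Logic L) : Prop :=
  ∀ (Γ : Set (Fm L)) (δ : Fm L), S.Thm Γ δ →
    ∃ Γ₀ : Finset (Fm L), ↑Γ₀ ⊆ Γ ∧ S.Thm ↑Γ₀ δ

/-- Filter-distributive logics: the lattice of `S`-filters of every algebra is
distributive. -/
def FilterDistributive (S : Logic L) : Prop :=
  ∀ (A : Type) (SA : AlgStr L A) (F G H : Set A),
    IsSFilter S SA F → IsSFilter S SA G → IsSFilter S SA H →
      F ∩ Fg S SA (G ∪ H) = Fg S SA ((F ∩ G) ∪ (F ∩ H))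

/-- `S`-ideals. -/
def IsSIdeal (S : Logic L) (SA : AlgStr L A) (I : Set A) : Prop :=
  ∀ I' : Finset A, ↑I' ⊆ I → ∀ a : A,
    (⋂ b ∈ I', Fg S SA {b}) ⊆ Fg S SA {a} → a ∈ I

/-- The strong-ideal condition. -/
def StrongIdealCond (S : Logic L) (SA : AlgStr L A) (I : Set A) : Prop :=
  ∀ I' : Finset A, ↑I' ⊆ I → ∀ B : Finset A, B.Nonempty →
    (⋂ b ∈ I', Fg S SA {b}) ⊆ Fg S SA ↑B → (Fg S SA ↑B ∩ I).Nonempty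

/-- Strong `S`-ideals. -/
def IsStrongSIdeal (S : Logic L) (SA : AlgStr L A) (I : Set A) : Prop :=
  IsSIdeal S SA I ∧ StrongIdealCond S SA I

/-- Optimal `S`-filters. -/
def IsOptimalSFilter (S : Logic L) (SA : AlgStr L A) (F : Set A) : Prop :=
  IsSFilter S SA F ∧ ∃ I : Set A, IsStrongSIdeal S SA I ∧ F ∩ I = ∅ ∧
    (∀ G, IsSFilter S SA G → G ∩ I = ∅ → F ⊆ G → G = F) ∧
    (∀ J, IsStrongSIdeal S SA J → F ∩ J = ∅ → I ⊆ J → J = I)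

/-- Irreducible `S`-filters: meet-irreducible elements of the lattice of
`S`-filters. -/
def IsIrrSFilter (S : Logic L) (SA : AlgStr L A) (F : Set A) : Prop :=
  IsSFilter S SA F ∧ F ≠ Set.univ ∧
    ∀ G H, IsSFilter S SA G → IsSFilter S SA H → F = G ∩ H → F = G ∨ F = H

/-- Order ideals of the poset `(A, ≤)` given by the specialization order. -/
def IsSpecOrderIdeal (S : Logic L) (SA : AlgStr L A) (I : Set A) : Prop :=
  I.Nonempty ∧ (∀ a ∈ I, ∀ b, SpecLe S SA b a → b ∈ I) ∧ DirectedOn (SpecLe S SA) I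

/-- Bottom families. -/
def IsBottomFamily (S : Logic L) (SA : AlgStr L A) (U : Finset A) : Prop :=
  U.Nonempty ∧ (∀ a ∈ U, ∀ b ∈ U, a ≠ b → ¬ SpecLe S SA a b) ∧
    Fg S SA ↑U = Set.univ

/-- `S`-prime subsets. -/
def IsSPrime (S : Logic L) (SA : AlgStr L A) (X : Set A) : Prop :=
  X ≠ Set.univ ∧ ∀ B : Finset A, B.Nonempty →
    (Fg S SA ↑B ∩ X).Nonempty → ((↑B : Set A) ∩ X).Nonempty

/-- Closure bases for the system of `S`-filters. -/
def IsClosureBase (S : Logic L) (SA : AlgStr L A) (𝓕 : Set (Set A)) : Prop :=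
  (∀ P ∈ 𝓕, IsSFilter S SA P) ∧
    ∀ F, IsSFilter S SA F → F = ⋂₀ {P | P ∈ 𝓕 ∧ F ⊆ P}

/-- The representation map `φ` relative to a closure base. -/
def Phi (𝓕 : Set (Set A)) (a : A) : Set (Set A) := {P | P ∈ 𝓕 ∧ a ∈ P}

/-- The extension `φ̂` of the representation map to subsets. -/
def PhiHat (𝓕 : Set (Set A)) (B : Set A) : Set (Set A) := {P | P ∈ 𝓕 ∧ B ⊆ P}

/-- The carrier of the `S`-semilattice `M(A)` relative to a closure base. -/
def MSet (𝓕 : Set (Set A)) : Set (Set (Set A)) :=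
  {U | ∃ B : Finset A, U = PhiHat 𝓕 ↑B}

/-- Filters of the meet-semilattice with carrier `MA` (ordered by inclusion,
with meet the binary intersection). -/
def IsMFilter (MA G : Set (Set (Set A))) : Prop :=
  G ⊆ MA ∧ G.Nonempty ∧ (∀ U ∈ G, ∀ V ∈ MA, U ⊆ V → V ∈ G) ∧
    ∀ U ∈ G, ∀ V ∈ G, U ∩ V ∈ G

/-- The filter of the meet-semilattice `MA` generated by a subset. -/
def MGen (MA X : Set (Set (Set A))) : Set (Set (Set A)) :=
  ⋂₀ {G | IsMFilter MA G ∧ X ⊆ G}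

/-- Frink ideals of the meet-semilattice with carrier `MA`. -/
def IsMFrinkIdeal (MA J : Set (Set (Set A))) : Prop :=
  J ⊆ MA ∧ ∀ J' : Finset (Set (Set A)), ↑J' ⊆ J → ∀ b ∈ MA,
    (∀ c ∈ MA, (∀ a ∈ J', a ⊆ c) → b ⊆ c) → b ∈ J

/-- The Frink ideal of the meet-semilattice `MA` generated by a subset. -/
def MFrinkGen (MA X : Set (Set (Set A))) : Set (Set (Set A)) :=
  ⋂₀ {J | IsMFrinkIdeal MA J ∧ X ⊆ J}

/-- `∧`-prime subsets of the meet-semilattice with carrier `MA`. -/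
def IsMPrime (MA X : Set (Set (Set A))) : Prop :=
  X ⊆ MA ∧ X ≠ MA ∧ ∀ U : Finset (Set (Set A)), U.Nonempty → ↑U ⊆ MA →
    ⋂₀ ↑U ∈ X → ∃ u ∈ U, u ∈ X

/-- Optimal filters of the meet-semilattice with carrier `MA`. -/
def IsMOptFilter (MA F : Set (Set (Set A))) : Prop :=
  IsMFilter MA F ∧ ∃ I, IsMFrinkIdeal MA I ∧ F ∩ I = ∅ ∧
    (∀ G, IsMFilter MA G → G ∩ I = ∅ → F ⊆ G → G = F) ∧
    (∀ J, IsMFrinkIdeal MA J → F ∩ J = ∅ → I ⊆ J → J = I)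

/-- The filter generated by a member of `Fg S SA B` is contained in `Fg S SA B`. -/
theorem Fg_singleton_subset_Fg {S : Logic L} {SA : AlgStr L A} {B : Set A} {c : A}
    (hc : c ∈ Fg S SA B) : Fg S SA {c} ⊆ Fg S SA B :=
  fun _ hx F hF => hx F ⟨hF.1, Set.singleton_subset_iff.2 (hc F hF)⟩

/-- For a congruential logic `S` and an `S`-algebra, a set is a strong
`S`-ideal iff it is a down-set w.r.t. the specialization order and satisfies
the strong-ideal condition. -/
theorem strong_ideal_iff_downset_and_strong_cond
    {L : Lang} (S : Logic L) {A : Type} (SA : AlgStr L A)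
    (hcong : Congruential S) (halg : IsSAlgebra S SA) (I : Set A) :
    IsStrongSIdeal S SA I ↔
      ((∀ a ∈ I, ∀ b : A, SpecLe S SA b a → b ∈ I) ∧ StrongIdealCond S SA I) := by
  constructor
  · rintro ⟨hI, hs⟩
    refine ⟨fun a ha b hab => hI {a} (by simpa using ha) b ?_, hs⟩
    simpa [SpecLe] using hab
  · rintro ⟨hd, hs⟩
    refine ⟨fun I' hI' a ha => ?_, hs⟩
    obtain ⟨c, hc, hcI⟩ := hs I' hI' {a} (Finset.singleton_nonempty a) (by simpa using ha)
    rw [Finset.coe_singleton] at hc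
    exact hd c hcI a (Fg_singleton_subset_Fg hc)
end

section
/- Let S be a finitary congruential logic, A an S-algebra, F an S-filter of A and I a strong S-ideal of A such that F ∩ I = ∅. Then there exists an optimal S-filter Q of A such that F ⊆ Q and Q ∩ I = ∅. -/
variable {L : Lang} {A : Type}

/-- A directed nonempty union of filters of a finitary logic is a filter. -/
theorem IsSFilter.sUnion {L : Lang} {S : Logic L} {A : Type} {SA : AlgStr L A}
    (hfin : Finitary S) {c : Set (Set A)} (hne : c.Nonempty) (hdir : DirectedOn (· ⊆ ·) c)
    (hc : ∀ F ∈ c, IsSFilter S SA F) : IsSFilter S SA (⋃₀ c) := by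
  intro h hh Γ δ hΓ hmem
  obtain ⟨Γ₀, hsub, hΓ₀⟩ := hfin Γ δ hΓ
  have hfinite : (h '' (Γ₀ : Set (Fm L))).Finite := Γ₀.finite_toSet.image h
  obtain ⟨G, hG, hGsub⟩ := hdir.exists_mem_subset_of_finite_of_subset_sUnion hne hfinite
    (Set.image_subset_iff.2 fun γ hγ => hmem γ (hsub hγ))
  exact ⟨G, hG, hc G hG h hh Γ₀ δ hΓ₀ fun γ hγ => hGsub ⟨γ, hγ, rfl⟩⟩

/-- A directed nonempty union of strong ideals is a strong ideal. -/
theorem IsStrongSIdeal.sUnion {L : Lang} {S : Logic L} {A : Type} {SA : AlgStr L A}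
    {c : Set (Set A)} (hne : c.Nonempty) (hdir : DirectedOn (· ⊆ ·) c)
    (hc : ∀ I ∈ c, IsStrongSIdeal S SA I) : IsStrongSIdeal S SA (⋃₀ c) := by
  constructor
  · intro I' hI' a ha
    obtain ⟨J, hJ, hJsub⟩ := hdir.exists_mem_subset_of_finite_of_subset_sUnion hne
      I'.finite_toSet hI'
    exact ⟨J, hJ, (hc J hJ).1 I' hJsub a ha⟩
  · intro I' hI' B hB hsub
    obtain ⟨J, hJ, hJsub⟩ := hdir.exists_mem_subset_of_finite_of_subset_sUnion hne
      I'.finite_toSet hI'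
    exact ((hc J hJ).2 I' hJsub B hB hsub).mono
      (Set.inter_subset_inter_right _ (Set.subset_sUnion_of_mem hJ))

/-- Optimal `S`-filter lemma: an `S`-filter disjoint from a strong `S`-ideal
extends to an optimal `S`-filter disjoint from it. -/
theorem optimal_filter_lemma
    {L : Lang} (S : Logic L) {A : Type} (SA : AlgStr L A)
    (hfin : Finitary S) (hcong : Congruential S) (halg : IsSAlgebra S SA)
    (F I : Set A) (hF : IsSFilter S SA F) (hI : IsStrongSIdeal S SA I)
    (hdisj : F ∩ I = ∅) :
    ∃ Q : Set A, IsOptimalSFilter S SA Q ∧ F ⊆ Q ∧ Q ∩ I = ∅ := by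
  obtain ⟨⟨Q, J⟩, ⟨hFQ, hIJ⟩, hmax⟩ := zorn_le_nonempty₀
    {p : Set A × Set A | IsSFilter S SA p.1 ∧ IsStrongSIdeal S SA p.2 ∧ p.1 ∩ p.2 = ∅}
    (by
      intro c hc hchain p hp
      have hdir : DirectedOn (· ≤ ·) c := hchain.directedOn
      have hdirF : DirectedOn (· ⊆ ·) (Prod.fst '' c) :=
        directedOn_image.2 (hdir.mono fun _ _ h => h.1)
      have hdirI : DirectedOn (· ⊆ ·) (Prod.snd '' c) :=
        directedOn_image.2 (hdir.mono fun _ _ h => h.2)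
      refine ⟨(⋃₀ (Prod.fst '' c), ⋃₀ (Prod.snd '' c)), ⟨?_, ?_, ?_⟩, ?_⟩
      · refine IsSFilter.sUnion hfin ⟨_, p, hp, rfl⟩ hdirF ?_
        rintro _ ⟨q, hq, rfl⟩
        exact (hc hq).1
      · refine IsStrongSIdeal.sUnion ⟨_, p, hp, rfl⟩ hdirI ?_
        rintro _ ⟨q, hq, rfl⟩
        exact (hc hq).2.1
      · refine Set.eq_empty_of_forall_notMem ?_
        rintro a ⟨⟨_, ⟨q, hq, rfl⟩, haq⟩, ⟨_, ⟨r, hr, rfl⟩, har⟩⟩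
        obtain ⟨s, hs, hqs, hrs⟩ := hdir q hq r hr
        exact (Set.ext_iff.1 (hc hs).2.2 a).1 ⟨hqs.1 haq, hrs.2 har⟩
      · intro q hq
        exact ⟨Set.subset_sUnion_of_mem ⟨q, hq, rfl⟩, Set.subset_sUnion_of_mem ⟨q, hq, rfl⟩⟩)
    (F, I) ⟨hF, hI, hdisj⟩
  obtain ⟨hQ, hJ, hQJ⟩ := hmax.prop
  refine ⟨Q, ⟨hQ, J, hJ, hQJ, ?_, ?_⟩, hFQ, ?_⟩
  · intro G hG hGJ hQG
    exact congrArg Prod.fst (hmax.eq_of_ge (y := (G, J)) ⟨hG, hJ, hGJ⟩ ⟨hQG, le_rfl⟩)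
  · intro K hK hQK hJK
    exact congrArg Prod.snd (hmax.eq_of_ge (y := (Q, K)) ⟨hQ, hK, hQK⟩ ⟨le_rfl, hJK⟩)
  · exact Set.subset_eq_empty (Set.inter_subset_inter_right Q hIJ) hQJ
end

section
/- Let S be a finitary congruential logic, A an S-algebra, F an S-filter of A and I an order ideal of the poset (A, ≤) such that F ∩ I = ∅. Then there exists an irreducible S-filter Q of A such that F ⊆ Q and Q ∩ I = ∅. -/
variable {L : Lang} {A : Type}

theorem IsSFilter.mem_of_specLe {L : Lang} {A : Type} {S : Logic L} {SA : AlgStr L A}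
    {F : Set A} (hF : IsSFilter S SA F) {a b : A} (ha : a ∈ F) (hab : SpecLe S SA a b) :
    b ∈ F := by
  have hb : b ∈ Fg S SA {b} := fun G hG => hG.2 rfl
  exact hab hb F ⟨hF, Set.singleton_subset_iff.2 ha⟩

/-- For a finitary logic, the union of a nonempty directed family of filters is a filter. -/
theorem IsSFilter.sUnion_of_directedOn {L : Lang} {A : Type} {S : Logic L} {SA : AlgStr L A}
    (hfin : Finitary S) {c : Set (Set A)} (hne : c.Nonempty) (hdir : DirectedOn (· ⊆ ·) c)
    (hc : ∀ F ∈ c, IsSFilter S SA F) : IsSFilter S SA (⋃₀ c) := by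
  intro h hh Γ δ hΓ hmem
  obtain ⟨Γ₀, hsub, hΓ₀⟩ := hfin Γ δ hΓ
  have hcov : h '' (Γ₀ : Set (Fm L)) ⊆ ⋃₀ c := by
    rintro _ ⟨γ, hγ, rfl⟩
    exact hmem γ (hsub hγ)
  obtain ⟨G, hG, hGsub⟩ :=
    hdir.exists_mem_subset_of_finite_of_subset_sUnion hne (Γ₀.finite_toSet.image h) hcov
  exact ⟨G, hG, hc G hG h hh _ _ hΓ₀ fun γ hγ => hGsub ⟨γ, hγ, rfl⟩⟩

/-- A filter that is maximal among the filters disjoint from an order ideal is irreducible. -/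
theorem IsSpecOrderIdeal.isIrrSFilter_of_maximal {L : Lang} {A : Type} {S : Logic L}
    {SA : AlgStr L A} {I Q : Set A} (hI : IsSpecOrderIdeal S SA I)
    (hQ : Maximal (fun G => IsSFilter S SA G ∧ G ∩ I = ∅) Q) : IsIrrSFilter S SA Q := by
  obtain ⟨hne, -, hdir⟩ := hI
  refine ⟨hQ.prop.1, ?_, fun G H hG hH hQGH => ?_⟩
  · rintro rfl
    exact hne.ne_empty (by simpa using hQ.prop.2)
  · have meets : ∀ K, IsSFilter S SA K → Q ⊆ K → Q ≠ K → (K ∩ I).Nonempty := by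
      intro K hK hQK hQne
      rw [Set.nonempty_iff_ne_empty]
      exact fun h => hQne (hQ.eq_of_subset ⟨hK, h⟩ hQK)
    by_contra! hcon
    obtain ⟨a, haG, haI⟩ := meets G hG (hQGH ▸ Set.inter_subset_left) hcon.1
    obtain ⟨b, hbH, hbI⟩ := meets H hH (hQGH ▸ Set.inter_subset_right) hcon.2
    obtain ⟨d, hdI, had, hbd⟩ := hdir a haI b hbI
    have hdQ : d ∈ Q := hQGH ▸ ⟨hG.mem_of_specLe haG had, hH.mem_of_specLe hbH hbd⟩
    exact Set.eq_empty_iff_forall_notMem.1 hQ.prop.2 d ⟨hdQ, hdI⟩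

/-- Irreducible `S`-filter lemma: an `S`-filter disjoint from an order ideal of
the specialization poset extends to an irreducible `S`-filter disjoint from it. -/
theorem irreducible_filter_lemma
    {L : Lang} (S : Logic L) {A : Type} (SA : AlgStr L A)
    (hfin : Finitary S) (hcong : Congruential S) (halg : IsSAlgebra S SA)
    (F I : Set A) (hF : IsSFilter S SA F) (hI : IsSpecOrderIdeal S SA I)
    (hdisj : F ∩ I = ∅) :
    ∃ Q : Set A, IsIrrSFilter S SA Q ∧ F ⊆ Q ∧ Q ∩ I = ∅ := by
  obtain ⟨Q, hFQ, hQ⟩ := zorn_subset_nonempty {G | IsSFilter S SA G ∧ G ∩ I = ∅}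
    (fun c hc hchain hne => ⟨⋃₀ c,
      ⟨IsSFilter.sUnion_of_directedOn hfin hne hchain.directedOn fun G hG => (hc hG).1, by
        rw [Set.sUnion_eq_biUnion, Set.iUnion₂_inter]
        simpa using fun G hG => (hc hG).2⟩,
      fun G hG => Set.subset_sUnion_of_mem hG⟩) F ⟨hF, hdisj⟩
  exact ⟨Q, hI.isIrrSFilter_of_maximal hQ, hFQ, hQ.prop.2⟩
end

section
/- Let S be a filter-distributive, finitary, congruential logic and A an S-algebra. An S-filter F of A is optimal if and only if the complement A \ F is a strong S-ideal of A. -/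
variable {L : Lang} {A : Type}

section FilterGeneration

variable {S : Logic L} {SA : AlgStr L A}

theorem subset_Fg (B : Set A) : B ⊆ Fg S SA B := fun _ ha _ hF => hF.2 ha

theorem Fg_subset {B F : Set A} (hF : IsSFilter S SA F) (h : B ⊆ F) : Fg S SA B ⊆ F :=
  fun _ ha => ha F ⟨hF, h⟩

theorem IsSFilter.sInter {𝓕 : Set (Set A)} (h𝓕 : ∀ F ∈ 𝓕, IsSFilter S SA F) :
    IsSFilter S SA (⋂₀ 𝓕) :=
  fun h hh Γ δ hΓ hγ F hF => h𝓕 F hF h hh Γ δ hΓ fun γ hm => hγ γ hm F hF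

theorem IsSFilter.iInter {ι : Sort*} {F : ι → Set A} (hF : ∀ i, IsSFilter S SA (F i)) :
    IsSFilter S SA (⋂ i, F i) := by
  rw [← Set.sInter_range]
  exact IsSFilter.sInter (Set.forall_mem_range.2 hF)

theorem isSFilter_Fg (B : Set A) : IsSFilter S SA (Fg S SA B) :=
  IsSFilter.sInter fun _ hF => hF.1

theorem Fg_mono {B C : Set A} (h : B ⊆ C) : Fg S SA B ⊆ Fg S SA C :=
  Fg_subset (isSFilter_Fg C) (h.trans (subset_Fg C))

/-- For a finitary logic, filter generation is a finitary closure operator. -/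
theorem exists_finset_of_mem_Fg (hfin : Finitary S) {B : Set A} {a : A}
    (ha : a ∈ Fg S SA B) : ∃ B₀ : Finset A, ↑B₀ ⊆ B ∧ a ∈ Fg S SA ↑B₀ := by
  classical
  refine Fg_subset (F := {a | ∃ B₀ : Finset A, ↑B₀ ⊆ B ∧ a ∈ Fg S SA ↑B₀}) ?_ ?_ ha
  · intro h hh Γ δ hΓ hγ
    obtain ⟨Γ₀, hΓ₀, hthm⟩ := hfin Γ δ hΓ
    choose! X hXB hX using hγ
    refine ⟨Γ₀.biUnion X, ?_, ?_⟩
    · simpa using fun γ hm => hXB γ (hΓ₀ hm)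
    · exact isSFilter_Fg _ h hh _ _ hthm fun γ hm =>
        Fg_mono (Finset.coe_subset.2 (Finset.subset_biUnion_of_mem X hm)) (hX γ (hΓ₀ hm))
  · intro b hb
    exact ⟨{b}, by simpa using hb, subset_Fg _ (by simp)⟩

/-- In a distributive lattice of filters, joins distribute over binary meets. -/
theorem Fg_union_inter_subset (hdist : FilterDistributive S) {G P Q : Set A}
    (hG : IsSFilter S SA G) (hP : IsSFilter S SA P) (hQ : IsSFilter S SA Q) :
    Fg S SA (G ∪ P) ∩ Fg S SA (G ∪ Q) ⊆ Fg S SA (G ∪ (P ∩ Q)) := by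
  rw [hdist A SA _ G Q (isSFilter_Fg _) hG hQ]
  refine Fg_subset (isSFilter_Fg _) (Set.union_subset ?_ ?_)
  · exact fun x hx => subset_Fg _ (Or.inl hx.2)
  · rw [Set.inter_comm, hdist A SA Q G P hQ hG hP]
    exact Fg_mono (Set.union_subset_union Set.inter_subset_right (Set.inter_comm Q P).subset)

/-- In a distributive lattice of filters, joins distribute over finite meets. -/
theorem iInter_Fg_union_subset (hdist : FilterDistributive S) {G : Set A}
    (hG : IsSFilter S SA G) {ι : Type*} (s : Finset ι) {P : ι → Set A}
    (hP : ∀ i, IsSFilter S SA (P i)) :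
    (⋂ i ∈ s, Fg S SA (G ∪ P i)) ⊆ Fg S SA (G ∪ ⋂ i ∈ s, P i) := by
  classical
  induction s using Finset.induction_on with
  | empty => exact fun x _ => subset_Fg _ (Or.inr (by simp))
  | insert i s _ ih =>
    rw [Finset.set_biInter_insert, Finset.set_biInter_insert]
    exact (Set.inter_subset_inter_right _ ih).trans
      (Fg_union_inter_subset hdist hG (hP i)
        (IsSFilter.iInter fun j => IsSFilter.iInter fun _ => hP j))

/-- A filter that is maximal among those disjoint from a set satisfying the strong-ideal
condition contains no finitely generated filter above a finite meet of principal filters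
generated outside it. -/
theorem not_iInter_Fg_subset_of_maximal_disjoint (hdist : FilterDistributive S)
    (hfin : Finitary S) {F I : Set A} (hF : IsSFilter S SA F) (hI : StrongIdealCond S SA I)
    (hFI : F ∩ I = ∅) (hmax : ∀ G, IsSFilter S SA G → G ∩ I = ∅ → F ⊆ G → G = F)
    {K B : Finset A} (hK : ↑K ⊆ Fᶜ) (hB : B.Nonempty) (hBF : ↑B ⊆ F) :
    ¬ (⋂ b ∈ K, Fg S SA {b}) ⊆ Fg S SA ↑B := by
  classical
  intro hKB
  have key : ∀ b ∈ K, ∃ i ∈ I, ∃ C : Finset A, ↑C ⊆ F ∧ i ∈ Fg S SA (↑C ∪ {b}) := by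
    intro b hb
    have hmeet : (Fg S SA (F ∪ {b}) ∩ I).Nonempty := by
      rw [Set.nonempty_iff_ne_empty]
      intro h
      have heq := hmax _ (isSFilter_Fg _) h (Set.subset_union_left.trans (subset_Fg _))
      exact hK hb (heq ▸ subset_Fg (F ∪ {b}) (Or.inr rfl))
    obtain ⟨i, hi, hiI⟩ := hmeet
    obtain ⟨X, hX, hiX⟩ := exists_finset_of_mem_Fg hfin hi
    refine ⟨i, hiI, X.filter (· ∈ F), fun x hx => (Finset.mem_filter.1 hx).2,
      Fg_mono (fun x hx => ?_) hiX⟩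
    rcases hX hx with h | h
    · exact Or.inl (Finset.mem_coe.2 (Finset.mem_filter.2 ⟨hx, h⟩))
    · exact Or.inr h
  choose! i hiI C hCF hiC using key
  set D : Finset A := B ∪ K.biUnion C with hD
  have hDF : Fg S SA ↑D ⊆ F := by
    refine Fg_subset hF ?_
    rw [hD, Finset.coe_union]
    exact Set.union_subset hBF (by simpa using hCF)
  have hmeet : (⋂ c ∈ K.image i, Fg S SA {c}) ⊆ Fg S SA ↑D := by
    rw [Finset.set_biInter_finset_image]
    calc (⋂ b ∈ K, Fg S SA {i b})
        ⊆ ⋂ b ∈ K, Fg S SA (Fg S SA ↑D ∪ Fg S SA {b}) := by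
          refine Set.iInter₂_mono fun b hb => Fg_subset (isSFilter_Fg _) ?_
          rw [Set.singleton_subset_iff]
          refine Fg_mono (Set.union_subset_union ?_ (subset_Fg _)) (hiC b hb)
          exact (Finset.coe_subset.2 ((Finset.subset_biUnion_of_mem C hb).trans
            Finset.subset_union_right)).trans (subset_Fg _)
      _ ⊆ Fg S SA (Fg S SA ↑D ∪ ⋂ b ∈ K, Fg S SA {b}) :=
          iInter_Fg_union_subset hdist (isSFilter_Fg _) K fun _ => isSFilter_Fg _
      _ ⊆ Fg S SA ↑D := Fg_subset (isSFilter_Fg _) (Set.union_subset subset_rfl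
          (hKB.trans (Fg_mono (Finset.coe_subset.2 Finset.subset_union_left))))
  obtain ⟨x, hxD, hxI⟩ := hI (K.image i) (by simpa [Set.subset_def] using hiI) D
    (hB.mono Finset.subset_union_left) hmeet
  exact Set.eq_empty_iff_forall_notMem.1 hFI x ⟨hDF hxD, hxI⟩

end FilterGeneration

/-- For a filter-distributive, finitary, congruential logic and an `S`-algebra,
an `S`-filter is optimal iff its complement is a strong `S`-ideal. -/
theorem optimal_iff_compl_strong_ideal
    {L : Lang} (S : Logic L) {A : Type} (SA : AlgStr L A)
    (hdist : FilterDistributive S) (hfin : Finitary S)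
    (hcong : Congruential S) (halg : IsSAlgebra S SA)
    (F : Set A) (hF : IsSFilter S SA F) :
    IsOptimalSFilter S SA F ↔ IsStrongSIdeal S SA Fᶜ := by
  constructor
  · rintro ⟨-, I, ⟨-, hI⟩, hFI, hmax, -⟩
    have key {K B : Finset A} :=
      not_iInter_Fg_subset_of_maximal_disjoint hdist hfin hF hI hFI hmax (K := K) (B := B)
    refine ⟨fun K hK a hKa haF => ?_, fun K hK B hB hKB => ?_⟩
    · exact key (B := {a}) hK (Finset.singleton_nonempty a) (by simpa using haF)
        (by simpa using hKa)
    · have hBF : ¬ (↑B : Set A) ⊆ F := fun h => key hK hB h hKB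
      obtain ⟨b, hb, hbF⟩ := Set.not_subset.1 hBF
      exact ⟨b, subset_Fg _ hb, hbF⟩
  · intro h
    refine ⟨hF, Fᶜ, h, Set.inter_compl_self F, fun G _ hG hFG => ?_, fun J _ hJ hFJ => ?_⟩
    · exact (Set.disjoint_compl_right_iff_subset.1 (Set.disjoint_iff_inter_eq_empty.2 hG)).antisymm
        hFG
    · exact (Set.disjoint_iff_inter_eq_empty.2 hJ).symm.subset_compl_right.antisymm hFJ
end
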